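/- For every L > 0, every c ∈ ℝ and all x, y ∈ ℝ, ∫_ℝ (4πL)^{−1/2}·exp(−(x + z)²/(4L))·exp(−2L³/3 − L(z + y + 2c))·Ai(L² + z + y + 2c) dz = Ai(y − x + 2c), the integral being absolutely convergent. (This is the operator identity e^{LΔ̃}·e^{−LΔ}B₀,c = B̃₀,c.) -/

import Mathlib

open MeasureTheory

/-- The Airy function, defined by an absolutely convergent contour integral
over the vertical line `Re w = 1`. -/
noncomputable def Ai (x : ℝ) : ℝ :=
  (1 / (2 * Real.pi)) *
    ∫ t : ℝ, (Complex.exp ((1 + (t : ℂ) * Complex.I) ^ 3 / 3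
      - (1 + (t : ℂ) * Complex.I) * (x : ℂ))).re

/-- The integrand of the contour integral of the Airy function. -/
noncomputable def airyIntegrand (X : ℝ) (w : ℂ) : ℂ :=
  Complex.exp (w ^ 3 / 3 - w * (X : ℂ))

theorem differentiable_airyIntegrand (X : ℝ) : Differentiable ℂ (airyIntegrand X) := by
  unfold airyIntegrand
  fun_prop

theorem norm_airyIntegrand (X a t : ℝ) :
    ‖airyIntegrand X (a + t * Complex.I)‖
      = Real.exp (a ^ 3 / 3 - a * X) * Real.exp (-a * t ^ 2) := by
  have h : ((a : ℂ) + t * Complex.I) ^ 3 / 3 - (a + t * Complex.I) * (X : ℂ)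
      = ((a ^ 3 / 3 - a * X + -a * t ^ 2 : ℝ) : ℂ)
        + ((a ^ 2 * t - t ^ 3 / 3 - t * X : ℝ) : ℂ) * Complex.I := by
    push_cast
    linear_combination ((a : ℂ) * t ^ 2 + (t : ℂ) ^ 3 * Complex.I / 3) * Complex.I_sq
  rw [airyIntegrand, Complex.norm_exp, h, ← Real.exp_add]
  simp only [Complex.add_re, Complex.ofReal_re, Complex.re_ofReal_mul, Complex.I_re, mul_zero,
    add_zero]

theorem integrable_airyIntegrand (X : ℝ) {a : ℝ} (ha : 0 < a) :
    Integrable fun t : ℝ => airyIntegrand X (a + t * Complex.I) := by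
  refine ((integrable_exp_neg_mul_sq ha).const_mul (Real.exp (a ^ 3 / 3 - a * X))).mono' ?_ ?_
  · exact ((differentiable_airyIntegrand X).continuous.comp
      (by fun_prop : Continuous fun t : ℝ => (a : ℂ) + t * Complex.I)).aestronglyMeasurable
  · exact Filter.Eventually.of_forall fun t => (norm_airyIntegrand X a t).le

theorem norm_airyIntegrand_le (X : ℝ) {a b s : ℝ} (ha : 0 < a) (hs : s ∈ Set.Icc a b) (t : ℝ) :
    ‖airyIntegrand X (s + t * Complex.I)‖
      ≤ Real.exp (b ^ 3 / 3 + b * |X|) * Real.exp (-a * t ^ 2) := by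
  obtain ⟨h1, h2⟩ := hs
  rw [norm_airyIntegrand]
  gcongr
  have h4 : s ^ 3 ≤ b ^ 3 := by gcongr; linarith
  have h5 : -(s * X) ≤ b * |X| :=
    calc -(s * X) = s * (-X) := by ring
      _ ≤ s * |X| := by gcongr; linarith; exact neg_le_abs X
      _ ≤ b * |X| := by gcongr
  linarith

/-- The contour of the Airy integral may be moved to any vertical line in the right half-plane. -/
theorem integral_airyIntegrand_eq (X : ℝ) {a b : ℝ} (ha : 0 < a) (hab : a ≤ b) :
    ∫ t : ℝ, airyIntegrand X (b + t * Complex.I)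
      = ∫ t : ℝ, airyIntegrand X (a + t * Complex.I) := by
  have lim (r : ℝ) (hr : 0 < r) : Filter.Tendsto
      (fun T : ℝ => ∫ t in (-T)..T, airyIntegrand X (r + t * Complex.I)) Filter.atTop
      (nhds (∫ t : ℝ, airyIntegrand X (r + t * Complex.I))) :=
    intervalIntegral_tendsto_integral (integrable_airyIntegrand X hr)
      Filter.tendsto_neg_atTop_atBot Filter.tendsto_id
  have decay : Filter.Tendsto (fun T : ℝ => Real.exp (-a * T ^ 2)) Filter.atTop (nhds 0) := by
    refine Real.tendsto_exp_atBot.comp ?_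
    exact (Filter.tendsto_pow_atTop two_ne_zero).const_mul_atTop_of_neg (neg_lt_zero.2 ha)
  have edge (σ : ℝ) (hσ : σ ^ 2 = 1) : Filter.Tendsto
      (fun T : ℝ => ∫ s in a..b, airyIntegrand X (s + (σ * T : ℝ) * Complex.I)) Filter.atTop
      (nhds 0) := by
    have hbd := (decay.const_mul (Real.exp (b ^ 3 / 3 + b * |X|))).mul_const |b - a|
    rw [mul_zero, zero_mul] at hbd
    refine squeeze_zero_norm (fun T => ?_) hbd
    refine intervalIntegral.norm_integral_le_of_norm_le_const fun s hs => ?_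
    rw [Set.uIoc_of_le hab] at hs
    have := norm_airyIntegrand_le X ha (Set.Ioc_subset_Icc_self hs) (σ * T)
    rwa [mul_pow, hσ, one_mul] at this
  have rect (T : ℝ) := Complex.integral_boundary_rect_eq_zero_of_differentiableOn
    (airyIntegrand X) (a + (-T : ℝ) * Complex.I) (b + T * Complex.I)
    (differentiable_airyIntegrand X).differentiableOn
  simp only [Complex.add_re, Complex.ofReal_re, Complex.re_ofReal_mul, Complex.I_re, mul_zero,
    add_zero, Complex.add_im, Complex.ofReal_im, Complex.im_ofReal_mul, Complex.I_im, mul_one,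
    zero_add] at rect
  have hlim := (((edge (-1) (by norm_num)).sub (edge 1 (by norm_num))).add
    ((lim b (ha.trans_le hab)).const_smul Complex.I)).sub ((lim a ha).const_smul Complex.I)
  simp only [neg_mul, one_mul] at hlim
  have h0 := tendsto_nhds_unique (hlim.congr rect) tendsto_const_nhds
  simp only [sub_zero, zero_add, smul_eq_mul, ← mul_sub] at h0
  exact sub_eq_zero.1 ((mul_eq_zero.1 h0).resolve_left Complex.I_ne_zero)

theorem Ai_eq_re (X : ℝ) :
    Ai X = (1 / (2 * Real.pi)) * (∫ t : ℝ, airyIntegrand X ((1 : ℝ) + t * Complex.I)).re := by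
  have h := integral_re (integrable_airyIntegrand X one_pos)
  simp only [RCLike.re_eq_complex_re] at h
  rw [← h, Ai]
  simp only [airyIntegrand, Complex.ofReal_one]

/-- The product of the reflected heat kernel and the exponential factor of the backwards heat
kernel. -/
noncomputable def heatWeight (L x d z : ℝ) : ℝ :=
  (4 * Real.pi * L) ^ (-(1 : ℝ) / 2) * Real.exp (-(x + z) ^ 2 / (4 * L)) *
    Real.exp (-2 * L ^ 3 / 3 - L * (z + d))

theorem integral_heatWeight_mul_airyIntegrand {L : ℝ} (hL : 0 < L) (x d : ℝ) (w : ℂ) :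
    ∫ z : ℝ, (heatWeight L x d z : ℂ) * airyIntegrand (L ^ 2 + z + d) w
      = airyIntegrand (d - x) (w + L) := by
  have hL' : (L : ℂ) ≠ 0 := by exact_mod_cast hL.ne'
  have hb : ((-1 / (4 * L) : ℝ) : ℂ).re < 0 := by
    rw [Complex.ofReal_re]
    exact div_neg_of_neg_of_pos (by norm_num) (by positivity)
  have hprod (z : ℝ) : (heatWeight L x d z : ℂ) * airyIntegrand (L ^ 2 + z + d) w
      = (((4 * Real.pi * L) ^ (-(1 : ℝ) / 2) : ℝ) : ℂ) *
        Complex.exp (((-1 / (4 * L) : ℝ) : ℂ) * z ^ 2 + (-x / (2 * L) - L - w) * z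
          + (-x ^ 2 / (4 * L) - 2 * L ^ 3 / 3 - L * d + w ^ 3 / 3 - w * (L ^ 2 + d))) := by
    rw [heatWeight, airyIntegrand, Complex.ofReal_mul, Complex.ofReal_mul, Complex.ofReal_exp,
      Complex.ofReal_exp, mul_assoc, mul_assoc, ← Complex.exp_add, ← Complex.exp_add]
    congr 2
    push_cast
    field_simp
    ring
  have hconst : (((4 * Real.pi * L) ^ (-(1 : ℝ) / 2) : ℝ) : ℂ) *
      ((Real.pi : ℂ) / -((-1 / (4 * L) : ℝ) : ℂ)) ^ (1 / 2 : ℂ) = 1 := by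
    have h1 : (Real.pi : ℂ) / -((-1 / (4 * L) : ℝ) : ℂ) = ((4 * Real.pi * L : ℝ) : ℂ) := by
      push_cast
      field_simp
    have h2 : (1 / 2 : ℂ) = ((1 / 2 : ℝ) : ℂ) := by push_cast; rfl
    rw [h1, h2, ← Complex.ofReal_cpow (by positivity), ← Complex.ofReal_mul,
      ← Real.rpow_add (by positivity)]
    norm_num
  simp_rw [hprod]
  rw [integral_const_mul, integral_cexp_quadratic hb, ← mul_assoc, hconst, one_mul, airyIntegrand]
  congr 1
  push_cast
  field_simp
  ring

theorem integrable_heatWeight_mul_exp {L : ℝ} (hL : 0 < L) (x d : ℝ) :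
    Integrable fun z : ℝ => heatWeight L x d z * Real.exp (1 / 3 - (L ^ 2 + z + d)) := by
  have hb : ((-1 / (4 * L) : ℝ) : ℂ).re < 0 := by
    rw [Complex.ofReal_re]
    exact div_neg_of_neg_of_pos (by norm_num) (by positivity)
  have h := ((integrable_cexp_quadratic' hb ((-x / (2 * L) - L - 1 : ℝ) : ℂ)
    ((-x ^ 2 / (4 * L) - 2 * L ^ 3 / 3 - L * d + 1 / 3 - (L ^ 2 + d) : ℝ) : ℂ)).re).const_mul
      ((4 * Real.pi * L) ^ (-(1 : ℝ) / 2))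
  refine h.congr (Filter.Eventually.of_forall fun z => ?_)
  simp only [RCLike.re_eq_complex_re, ← Complex.ofReal_pow, ← Complex.ofReal_mul,
    ← Complex.ofReal_add, Complex.exp_ofReal_re]
  rw [heatWeight]
  generalize (4 * Real.pi * L) ^ (-(1 : ℝ) / 2) = C
  rw [mul_assoc, mul_assoc, ← Real.exp_add, ← Real.exp_add]
  congr 2
  field_simp
  ring

theorem integrable_prod_heatWeight_mul_airyIntegrand {L : ℝ} (hL : 0 < L) (x d : ℝ) :
    Integrable fun p : ℝ × ℝ =>
      (heatWeight L x d p.1 : ℂ)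
        * airyIntegrand (L ^ 2 + p.1 + d) ((1 : ℝ) + p.2 * Complex.I) := by
  refine ((integrable_heatWeight_mul_exp hL x d).mul_prod
    (integrable_exp_neg_mul_sq one_pos)).mono' ?_ ?_
  · refine Continuous.aestronglyMeasurable ?_
    unfold heatWeight airyIntegrand
    fun_prop
  · refine Filter.Eventually.of_forall fun p => le_of_eq ?_
    have h0 : 0 ≤ heatWeight L x d p.1 := by unfold heatWeight; positivity
    rw [norm_mul, norm_airyIntegrand, Complex.norm_of_nonneg h0, one_pow, one_mul, mul_assoc]

/-- The operator identity `e^{LΔ̃}·e^{-LΔ}B₀,c = B̃₀,c` at the kernel level: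
`∫_ℝ (4πL)^{-1/2} e^{-(x+z)²/(4L)} e^{-2L³/3 - L(z+y+2c)} Ai(L²+z+y+2c) dz = Ai(y-x+2c)`. -/
theorem heat_tilde_inv_heat_B (L c x y : ℝ) (hL : 0 < L) :
    Integrable (fun z : ℝ =>
      (4 * Real.pi * L) ^ (-(1 : ℝ) / 2) * Real.exp (-(x + z) ^ 2 / (4 * L)) *
        (Real.exp (-2 * L ^ 3 / 3 - L * (z + y + 2 * c)) * Ai (L ^ 2 + z + y + 2 * c))) ∧
    (∫ z : ℝ,
        (4 * Real.pi * L) ^ (-(1 : ℝ) / 2) * Real.exp (-(x + z) ^ 2 / (4 * L)) *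
          (Real.exp (-2 * L ^ 3 / 3 - L * (z + y + 2 * c)) * Ai (L ^ 2 + z + y + 2 * c)))
      = Ai (y - x + 2 * c) := by
  set d := y + 2 * c with hd
  have hint := integrable_prod_heatWeight_mul_airyIntegrand hL x d
  have hz := hint.integral_prod_left
  have hfun : (fun z : ℝ =>
      (4 * Real.pi * L) ^ (-(1 : ℝ) / 2) * Real.exp (-(x + z) ^ 2 / (4 * L)) *
        (Real.exp (-2 * L ^ 3 / 3 - L * (z + y + 2 * c)) * Ai (L ^ 2 + z + y + 2 * c)))
      = fun z : ℝ => (1 / (2 * Real.pi)) * RCLike.re (∫ t : ℝ, (heatWeight L x d z : ℂ)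
        * airyIntegrand (L ^ 2 + z + d) ((1 : ℝ) + t * Complex.I)) := by
    funext z
    rw [integral_const_mul, RCLike.re_eq_complex_re, Complex.re_ofReal_mul, heatWeight,
      add_assoc z, add_assoc (L ^ 2 + z), ← hd, Ai_eq_re]
    ring
  rw [hfun]
  refine ⟨hz.re.const_mul _, ?_⟩
  rw [integral_const_mul, integral_re hz, integral_integral_swap hint]
  simp_rw [integral_heatWeight_mul_airyIntegrand hL]
  have hshift := integral_airyIntegrand_eq (d - x) one_pos (le_add_of_nonneg_right hL.le)
  rw [show y - x + 2 * c = d - x by rw [hd]; ring, Ai_eq_re, ← hshift, RCLike.re_eq_complex_re]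
  congr 4
  funext t
  congr 1
  push_cast
  ring
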